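/- Let n ≥ 2, ε > 0, p ∈ ℤ^{2n+1}, j ∈ {1,…,2n}, c ∈ {εp_j, εp_j + ε} and c' ∈ {εp_{2n+1}, εp_{2n+1} + ε}, and let S = {w ∈ Q_{εp,ε} : w_j = c, w_{2n+1} = c'} be a 2-codimensional subface of the cube Q_{εp,ε}. Then at every point of the relative interior S° = {w ∈ S : εp_i < w_i < εp_i + ε for all i ∉ {j, 2n+1}}, the horizontal gradients of h₁(w) = c − w_j and h₂(w) = c' − w_{2n+1} are linearly independent vectors of ℝ^{2n}; consequently S° is an H-regular 2-codimensional surface. -/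

import Mathlib

/-- The index of the horizontal coordinate `w_j` (`j ∈ {1,…,2n}`) inside
`ℝ^{2n+1}`. -/
def hIdx (n : ℕ) (j : Fin (2 * n)) : Fin (2 * n + 1) := j.castSucc

/-- The index of the vertical coordinate `t = w_{2n+1}` inside `ℝ^{2n+1}`. -/
def tIdx (n : ℕ) : Fin (2 * n + 1) := Fin.last (2 * n)

/-- `w̃_j`: equal to `w_{n+j}` for `j = 1,…,n` and to `−w_{j−n}` for
`j = n+1,…,2n`. -/
def tilde (n : ℕ) (j : Fin (2 * n)) (w : Fin (2 * n + 1) → ℝ) : ℝ :=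
  if h : (j : ℕ) < n then w (hIdx n ⟨n + j, by omega⟩)
  else -w (hIdx n ⟨(j : ℕ) - n, by have := j.isLt; omega⟩)

/-- The value at `w` of the left-invariant horizontal vector field
`W_j = ∂_{w_j} − (1/2) w̃_j ∂_t`, as a vector of ℝ^{2n+1}. -/
noncomputable def Wvec (n : ℕ) (j : Fin (2 * n)) (w : Fin (2 * n + 1) → ℝ) :
    Fin (2 * n + 1) → ℝ :=
  fun i => (if i = hIdx n j then 1 else 0) +
    (if i = tIdx n then -(1 / 2) * tilde n j w else 0)

/-- The horizontal gradient `∇_H f(w) = (W_1 f(w),…,W_{2n} f(w)) ∈ ℝ^{2n}`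
(whose first `n` entries are the `X_j f` and last `n` entries the `Y_j f`). -/
noncomputable def gradH (n : ℕ) (f : (Fin (2 * n + 1) → ℝ) → ℝ)
    (w : Fin (2 * n + 1) → ℝ) : Fin (2 * n) → ℝ :=
  fun j => fderiv ℝ f w (Wvec n j w)

/-- `S ⊆ ℝ^{2n+1}` is an H-regular 1-codimensional surface: near each of its
points, `S` is the zero set of a `C¹` function with nonvanishing horizontal
gradient. -/
def IsHRegular1 (n : ℕ) (S : Set (Fin (2 * n + 1) → ℝ)) : Prop :=
  ∀ p ∈ S, ∃ U : Set (Fin (2 * n + 1) → ℝ), IsOpen U ∧ p ∈ U ∧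
    ∃ f : (Fin (2 * n + 1) → ℝ) → ℝ, ContDiffOn ℝ 1 f U ∧
      S ∩ U = {w ∈ U | f w = 0} ∧ ∀ w ∈ U, gradH n f w ≠ 0

/-- `S ⊆ ℝ^{2n+1}` is an H-regular 2-codimensional surface: near each of its
points, `S` is the common zero set of a pair of `C¹` functions whose horizontal
gradients are linearly independent. -/
def IsHRegular2 (n : ℕ) (S : Set (Fin (2 * n + 1) → ℝ)) : Prop :=
  ∀ p ∈ S, ∃ U : Set (Fin (2 * n + 1) → ℝ), IsOpen U ∧ p ∈ U ∧
    ∃ f₁ f₂ : (Fin (2 * n + 1) → ℝ) → ℝ, ContDiffOn ℝ 1 f₁ U ∧ ContDiffOn ℝ 1 f₂ U ∧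
      S ∩ U = {w ∈ U | f₁ w = 0 ∧ f₂ w = 0} ∧
      ∀ w ∈ U, LinearIndependent ℝ ![gradH n f₁ w, gradH n f₂ w]

theorem gradH_const_sub_coord (n : ℕ) (a : ℝ) (i : Fin (2 * n + 1))
    (w : Fin (2 * n + 1) → ℝ) (k : Fin (2 * n)) :
    gradH n (fun w => a - w i) w k = -Wvec n k w i := by
  have h : HasFDerivAt (fun w : Fin (2 * n + 1) → ℝ => a - w i)
      (-ContinuousLinearMap.proj (R := ℝ) (φ := fun _ : Fin (2 * n + 1) => ℝ) i) w :=
    (hasFDerivAt_apply i w).const_sub a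
  simp [gradH, h.fderiv]

theorem Wvec_hIdx (n : ℕ) (k j : Fin (2 * n)) (w : Fin (2 * n + 1) → ℝ) :
    Wvec n k w (hIdx n j) = if j = k then 1 else 0 := by
  simp [Wvec, hIdx, tIdx, Fin.castSucc_ne_last]

theorem Wvec_tIdx (n : ℕ) (k : Fin (2 * n)) (w : Fin (2 * n + 1) → ℝ) :
    Wvec n k w (tIdx n) = -(1 / 2) * tilde n k w := by
  simp [Wvec, hIdx, tIdx, (Fin.castSucc_ne_last k).symm]

/-- The horizontal gradients of `c - w_j` and `c' - t` are independent as soon as some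
`w̃_k` with `k ≠ j` does not vanish. -/
theorem linearIndependent_gradH_coords (n : ℕ) (c c' : ℝ) {j k : Fin (2 * n)} (hkj : k ≠ j)
    {w : Fin (2 * n + 1) → ℝ} (hk : tilde n k w ≠ 0) :
    LinearIndependent ℝ ![gradH n (fun w => c - w (hIdx n j)) w,
      gradH n (fun w => c' - w (tIdx n)) w] := by
  rw [LinearIndependent.pair_iff]
  intro s t hst
  have ht : t = 0 := by
    simpa [gradH_const_sub_coord, Wvec_hIdx, Wvec_tIdx, hkj.symm, hk] using congrFun hst k
  subst ht
  exact ⟨by simpa [gradH_const_sub_coord, Wvec_hIdx] using congrFun hst j, rfl⟩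

/-- The open cell `(εm, εm + ε)` of the grid `εℤ` does not contain the origin. -/
theorem ne_zero_of_mem_grid_cell {ε x : ℝ} (hε : 0 < ε) (m : ℤ)
    (h₁ : ε * m < x) (h₂ : x < ε * m + ε) : x ≠ 0 := by
  rintro rfl
  have hneg : (m : ℝ) < 0 := by
    by_contra! h
    exact absurd h₁ (not_lt.2 (mul_nonneg hε.le h))
  have hpos : (0 : ℝ) < m + 1 := by
    by_contra! h
    nlinarith
  have h₃ : m < 0 := by exact_mod_cast hneg
  have h₄ : 0 < m + 1 := by exact_mod_cast hpos
  omega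

/-- If all horizontal coordinates of `w` other than `w_j` are nonzero and `n ≥ 2`, then some
`w̃_k` with `k ≠ j` is nonzero. -/
theorem exists_tilde_ne_zero {n : ℕ} (hn : 2 ≤ n) (j : Fin (2 * n))
    {w : Fin (2 * n + 1) → ℝ} (hw : ∀ i, i ≠ j → w (hIdx n i) ≠ 0) :
    ∃ k, k ≠ j ∧ tilde n k w ≠ 0 := by
  obtain ⟨k, hkn, hkj, hnkj⟩ : ∃ k : ℕ, k < n ∧ k ≠ j ∧ n + k ≠ j := by
    by_cases h : (j : ℕ) = 0 ∨ (j : ℕ) = n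
    · exact ⟨1, by omega, by omega, by omega⟩
    · exact ⟨0, by omega, by omega, by omega⟩
  refine ⟨⟨k, by omega⟩, fun h => hkj (congrArg Fin.val h), ?_⟩
  simp only [tilde, hkn, dif_pos]
  exact hw _ fun h => hnkj (congrArg Fin.val h)

/-- Let `n ≥ 2`, `p ∈ ℤ^{2n+1}`, `j ∈ {1,…,2n}`, `c ∈ {εp_j, εp_j+ε}`,
`c' ∈ {εp_{2n+1}, εp_{2n+1}+ε}` and let `S° = {w : w_j = c, w_{2n+1} = c',
εp_i < w_i < εp_i + ε for i ∉ {j, 2n+1}}` be the relative interior of the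
corresponding 2-codimensional subface of `Q_{εp,ε}`. At every point of `S°`
the horizontal gradients of `h₁(w) = c − w_j` and `h₂(w) = c' − w_{2n+1}` are
linearly independent; consequently `S°` is an H-regular 2-codimensional
surface. -/
theorem subface_interior_HRegular2 (n : ℕ) (hn : 2 ≤ n) (ε : ℝ) (hε : 0 < ε)
    (p : Fin (2 * n + 1) → ℤ) (j : Fin (2 * n)) (c c' : ℝ)
    (hc : c = ε * p (hIdx n j) ∨ c = ε * p (hIdx n j) + ε)
    (hc' : c' = ε * p (tIdx n) ∨ c' = ε * p (tIdx n) + ε) :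
    (∀ w ∈ {w : Fin (2 * n + 1) → ℝ | w (hIdx n j) = c ∧ w (tIdx n) = c' ∧
        ∀ i : Fin (2 * n), i ≠ j →
          ε * p (hIdx n i) < w (hIdx n i) ∧ w (hIdx n i) < ε * p (hIdx n i) + ε},
      LinearIndependent ℝ ![gradH n (fun w => c - w (hIdx n j)) w,
        gradH n (fun w => c' - w (tIdx n)) w]) ∧
    IsHRegular2 n {w : Fin (2 * n + 1) → ℝ | w (hIdx n j) = c ∧ w (tIdx n) = c' ∧
        ∀ i : Fin (2 * n), i ≠ j →
          ε * p (hIdx n i) < w (hIdx n i) ∧ w (hIdx n i) < ε * p (hIdx n i) + ε} := by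
  have key : ∀ w : Fin (2 * n + 1) → ℝ, (∀ i : Fin (2 * n), i ≠ j →
      ε * p (hIdx n i) < w (hIdx n i) ∧ w (hIdx n i) < ε * p (hIdx n i) + ε) →
      LinearIndependent ℝ ![gradH n (fun w => c - w (hIdx n j)) w,
        gradH n (fun w => c' - w (tIdx n)) w] := by
    intro w hw
    obtain ⟨k, hkj, hk⟩ := exists_tilde_ne_zero hn j fun i hi =>
      ne_zero_of_mem_grid_cell hε _ (hw i hi).1 (hw i hi).2
    exact linearIndependent_gradH_coords n c c' hkj hk
  refine ⟨fun w hw => key w hw.2.2, fun q hq => ?_⟩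
  refine ⟨{w | ∀ i : Fin (2 * n), i ≠ j →
      ε * p (hIdx n i) < w (hIdx n i) ∧ w (hIdx n i) < ε * p (hIdx n i) + ε}, ?_, hq.2.2,
    fun w => c - w (hIdx n j), fun w => c' - w (tIdx n), ?_, ?_, ?_, key⟩
  · simp only [Set.ofPred_forall]
    refine isOpen_iInter_of_finite fun i => isOpen_iInter_of_finite fun _ => ?_
    exact (isOpen_lt continuous_const (continuous_apply _)).inter
      (isOpen_lt (continuous_apply _) continuous_const)
  · exact ContDiff.contDiffOn (by fun_prop)
  · exact ContDiff.contDiffOn (by fun_prop)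
  · ext w
    simp only [Set.mem_inter_iff, Set.mem_ofPred_eq, sub_eq_zero, eq_comm (a := c),
      eq_comm (a := c')]
    tauto
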